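/- arXiv:2505.24418 — 3 statements merged into one kernel-verified Lean document; each statement's English description precedes it below -/
import Mathlib

section
/- There exists a twice continuously differentiable function V : ℝ → ℝ (the pulse solution) such that V''(x) + f(V(x)) = 0 for all x ∈ ℝ, V(0) = β, V'(0) = 0, V(−x) = V(x) for all x, 0 < V(x) ≤ β for all x, V is strictly decreasing on [0,∞), and V(x) → 0 as x → ∞. -/
open Set Filter Topology

/-- The primitive `F(s) = ∫₀^s f(r) dr`. -/
noncomputable def F (f : ℝ → ℝ) (s : ℝ) : ℝ := ∫ r in (0:ℝ)..s, f r

/-- Bistable nonlinearity with balanced-positive integral. -/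
def Bistable (f : ℝ → ℝ) (a : ℝ) : Prop :=
  ContDiff ℝ 1 f ∧ 0 < a ∧ a < 1 ∧
  f 0 = 0 ∧ f a = 0 ∧ f 1 = 0 ∧
  (∀ s, 0 < s → s < a → f s < 0) ∧
  (∀ s, a < s → s < 1 → 0 < f s) ∧
  deriv f 0 < 0 ∧ 0 < deriv f a ∧ deriv f 1 < 0 ∧
  0 < ∫ s in (0:ℝ)..(1:ℝ), f s


/-- A Lipschitz vector field has a global integral curve as soon as it has one on each bounded
time interval. -/
theorem exists_global_of_forall_Ioo {E : Type*} [NormedAddCommGroup E] [NormedSpace ℝ E]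
    {X : E → E} {K : NNReal} (hX : LipschitzWith K X) {x₀ : E}
    (h : ∀ T : ℝ, 0 < T → ∃ γ : ℝ → E, γ 0 = x₀ ∧ ∀ t ∈ Ioo (-T) T, HasDerivAt γ (X (γ t)) t) :
    ∃ γ : ℝ → E, γ 0 = x₀ ∧ ∀ t, HasDerivAt γ (X (γ t)) t := by
  have h' : ∀ T : ℝ, ∃ γ : ℝ → E, γ 0 = x₀ ∧ ∀ t ∈ Ioo (-T) T, HasDerivAt γ (X (γ t)) t := by
    intro T
    obtain ⟨γ, h0, hγ⟩ := h (max T 1) (by positivity)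
    exact ⟨γ, h0, fun t ht => hγ t ⟨by have := le_max_left T 1; linarith [ht.1],
      ht.2.trans_le (le_max_left T 1)⟩⟩
  choose γ h0 hγ using h'
  have agree : ∀ S T : ℝ, 0 < S → S ≤ T → EqOn (γ S) (γ T) (Ioo (-S) S) := by
    intro S T hS hST
    refine ODE_solution_unique_of_mem_Ioo (v := fun _ => X) (s := fun _ => univ) (K := K)
      (t₀ := 0) (fun _ _ => hX.lipschitzOnWith) ⟨by linarith, hS⟩
      (fun t ht => ⟨hγ S t ht, trivial⟩)
      (fun t ht => ⟨hγ T t ⟨by linarith [ht.1], by linarith [ht.2]⟩, trivial⟩) ?_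
    rw [h0, h0]
  refine ⟨fun t => γ (|t| + 1) t, h0 _, fun t => ?_⟩
  have ht : t ∈ Ioo (-(|t| + 1)) (|t| + 1) := abs_lt.1 (lt_add_one _)
  refine (hγ (|t| + 1) t ht).congr_of_eventuallyEq ?_
  filter_upwards [Ioo_mem_nhds ht.1 ht.2] with s hs
  have hs' : s ∈ Ioo (-(|s| + 1)) (|s| + 1) := abs_lt.1 (lt_add_one _)
  rcases le_total (|s| + 1) (|t| + 1) with hle | hle
  · exact agree _ _ (by positivity) hle hs'
  · exact (agree _ _ (by positivity) hle hs).symm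

/-- The phase-plane field `(v, w) ↦ (c w, -g v)` is Lipschitz when `c` and `g` are. -/
theorem lipschitzWith_phaseField {c g : ℝ → ℝ} {K : NNReal} (hc : LipschitzWith 1 c)
    (hg : LipschitzWith K g) :
    LipschitzWith (max 1 K) fun p : ℝ × ℝ => (c p.2, -g p.1) := by
  have h₁ := (hg.comp (LipschitzWith.prod_fst (α := ℝ) (β := ℝ))).neg
  have h₂ := hc.comp (LipschitzWith.prod_snd (α := ℝ) (β := ℝ))
  rw [mul_one] at h₁ h₂
  exact h₂.prodMk h₁

/-- The equation `v'' + g(v) = 0` with `g` bounded and Lipschitz, written as a first-order system,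
has global solutions. -/
theorem exists_global_newton {g : ℝ → ℝ} {K : NNReal} {C : ℝ} (hg : LipschitzWith K g)
    (hC : ∀ s, |g s| ≤ C) (v₀ : ℝ) :
    ∃ v w : ℝ → ℝ, v 0 = v₀ ∧ w 0 = 0 ∧ (∀ t, HasDerivAt v (w t) t) ∧
      ∀ t, HasDerivAt w (-g (v t)) t := by
  have hC0 : 0 ≤ C := (abs_nonneg _).trans (hC 0)
  have hX : LipschitzWith (max 1 K) fun p : ℝ × ℝ => (p.2, -g p.1) :=
    lipschitzWith_phaseField LipschitzWith.id hg
  obtain ⟨γ, h0, hγ⟩ := exists_global_of_forall_Ioo hX (x₀ := (v₀, 0)) (fun T hT => by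
    -- truncate the velocity at a bound it cannot exceed before time `T`
    set c : ℝ → ℝ := fun w => max (-(C * T)) (min w (C * T)) with hc
    have hCT : 0 ≤ C * T := by positivity
    have hcL : LipschitzWith 1 c := (LipschitzWith.id.min_const _).const_max _
    have hcb : ∀ w, |c w| ≤ C * T := fun w =>
      abs_le.2 ⟨le_max_left _ _, max_le (by linarith) (min_le_right _ _)⟩
    let L : NNReal := ⟨max (C * T) C, le_max_of_le_right hC0⟩
    have hPL : IsPicardLindelof (fun _ (p : ℝ × ℝ) => (c p.2, -g p.1))
        (⟨0, by constructor <;> linarith⟩ : Icc (-T) T) ((v₀, 0) : ℝ × ℝ)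
        (L * ⟨T, hT.le⟩) 0 L (max 1 K) :=
      { lipschitzOnWith := fun _ _ => (lipschitzWith_phaseField hcL hg).lipschitzOnWith
        continuousOn := fun _ _ => continuousOn_const
        norm_le := fun _ _ p _ => by
          rw [Prod.norm_def]
          refine max_le ((hcb _).trans (le_max_left _ _)) ?_
          rw [norm_neg]
          exact (hC _).trans (le_max_right _ _)
        mul_max_le := by
          simp only [sub_zero, zero_sub, neg_neg, max_self, NNReal.coe_zero]
          exact le_rfl }
    obtain ⟨α, hα0, hα⟩ := hPL.exists_eq_forall_mem_Icc_hasDerivWithinAt₀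
    refine ⟨α, hα0, fun t ht => ?_⟩
    have hb : |(α t).2| ≤ C * T := by
      have := (convex_Icc (-T) T).norm_image_sub_le_of_norm_hasDerivWithin_le
        (f := fun t => (α t).2) (C := C) (fun s hs => (hα s hs).snd)
        (fun s _ => by rw [norm_neg]; exact hC _) (x := 0) (y := t)
        ⟨by linarith, hT.le⟩ (Ioo_subset_Icc_self ht)
      simp only at hα0
      rw [hα0] at this
      simp only [sub_zero, Real.norm_eq_abs] at this
      exact this.trans (mul_le_mul_of_nonneg_left (abs_lt.2 ht).le hC0)
    have := (hα t (Ioo_subset_Icc_self ht)).hasDerivAt (Icc_mem_nhds ht.1 ht.2)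
    have hcα : c (α t).2 = (α t).2 := by
      rw [hc]
      simp only
      rw [min_eq_left (abs_le.1 hb).2, max_eq_right (abs_le.1 hb).1]
    rwa [hcα] at this)
  exact ⟨fun t => (γ t).1, fun t => (γ t).2, by simp [h0], by simp [h0],
    fun t => (hγ t).fst, fun t => (hγ t).snd⟩

/-- Solutions of `v'' + g(v) = 0` with `g` Lipschitz are determined by their Cauchy data. -/
theorem newton_unique {g : ℝ → ℝ} {K : NNReal} (hg : LipschitzWith K g) {v w v' w' : ℝ → ℝ}
    (hv : ∀ t, HasDerivAt v (w t) t) (hw : ∀ t, HasDerivAt w (-g (v t)) t)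
    (hv' : ∀ t, HasDerivAt v' (w' t) t) (hw' : ∀ t, HasDerivAt w' (-g (v' t)) t)
    {t₀ : ℝ} (h₁ : v t₀ = v' t₀) (h₂ : w t₀ = w' t₀) : v = v' := by
  have hX : LipschitzWith (max 1 K) fun p : ℝ × ℝ => (p.2, -g p.1) :=
    lipschitzWith_phaseField LipschitzWith.id hg
  have := ODE_solution_unique_univ (v := fun _ (p : ℝ × ℝ) => (p.2, -g p.1))
    (s := fun _ => univ) (t₀ := t₀)
    (f := fun t => (v t, w t)) (g := fun t => (v' t, w' t)) (fun _ => hX.lipschitzOnWith)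
    (fun t => ⟨(hv t).prodMk (hw t), trivial⟩) (fun t => ⟨(hv' t).prodMk (hw' t), trivial⟩)
    (by simp [h₁, h₂])
  funext t
  exact congrArg Prod.fst (congrFun this t)

theorem hasDerivAt_F {g : ℝ → ℝ} (hg : Continuous g) (s : ℝ) : HasDerivAt (F g) (g s) s :=
  intervalIntegral.integral_hasDerivAt_right (hg.intervalIntegrable _ _)
    hg.stronglyMeasurable.stronglyMeasurableAtFilter hg.continuousAt

theorem continuous_F {g : ℝ → ℝ} (hg : Continuous g) : Continuous (F g) :=
  continuous_iff_continuousAt.2 fun s => (hasDerivAt_F hg s).continuousAt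

theorem strictMonoOn_F {g : ℝ → ℝ} {a : ℝ} (hg : Continuous g) (hpos : ∀ s, a < s → 0 < g s) :
    StrictMonoOn (F g) (Ici a) :=
  strictMonoOn_of_deriv_pos (convex_Ici a) (continuous_F hg).continuousOn fun x hx => by
    rw [interior_Ici] at hx
    rw [(hasDerivAt_F hg x).deriv]
    exact hpos x hx

theorem F_neg {g : ℝ → ℝ} {a β : ℝ} (hg : Continuous g) (ha : 0 < a)
    (hneg : ∀ s, 0 < s → s < a → g s < 0) (hpos : ∀ s, a < s → 0 < g s)
    (hβ : F g β = 0) {s : ℝ} (h0 : 0 < s) (hs : s < β) : F g s < 0 := by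
  rcases le_total s a with hsa | hsa
  · have hanti : StrictAntiOn (F g) (Icc 0 a) :=
      strictAntiOn_of_deriv_neg (convex_Icc 0 a) (continuous_F hg).continuousOn fun x hx => by
        rw [interior_Icc] at hx
        rw [(hasDerivAt_F hg x).deriv]
        exact hneg x hx.1 hx.2
    have := hanti ⟨le_rfl, ha.le⟩ ⟨h0.le, hsa⟩ h0
    rwa [show F g 0 = 0 from intervalIntegral.integral_same] at this
  · exact hβ ▸ strictMonoOn_F hg hpos hsa (hsa.trans hs.le) hs

theorem F_pos {g : ℝ → ℝ} {a β : ℝ} (hg : Continuous g) (hpos : ∀ s, a < s → 0 < g s)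
    (haβ : a < β) (hβ : F g β = 0) {s : ℝ} (hs : β < s) : 0 < F g s := by
  exact hβ ▸ strictMonoOn_F hg hpos haβ.le (haβ.le.trans hs.le) hs

/-- The mechanical energy of a solution of `v'' + g(v) = 0` is conserved. -/
theorem energy_eq {g : ℝ → ℝ} (hg : Continuous g) {v w : ℝ → ℝ}
    (hv : ∀ t, HasDerivAt v (w t) t) (hw : ∀ t, HasDerivAt w (-g (v t)) t) (s t : ℝ) :
    w s ^ 2 / 2 + F g (v s) = w t ^ 2 / 2 + F g (v t) := by
  have h : ∀ t, HasDerivAt (fun t => w t ^ 2 / 2 + F g (v t)) 0 t := fun t => by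
    refine ((((hw t).pow 2).div_const 2).add ((hasDerivAt_F hg (v t)).comp t (hv t))).congr_deriv ?_
    simp
    ring
  exact is_const_of_deriv_eq_zero (fun t => (h t).differentiableAt) (fun t => (h t).deriv) s t

/-- Pulses for a Lipschitz nonlinearity that stays positive to the right of `a`. -/
theorem exists_pulse_of_lipschitz {g : ℝ → ℝ} {K : NNReal} {C a β : ℝ} (hg : LipschitzWith K g)
    (hC : ∀ s, |g s| ≤ C) (ha : 0 < a) (haβ : a < β) (h0 : g 0 = 0)
    (hneg : ∀ s, 0 < s → s < a → g s < 0) (hpos : ∀ s, a < s → 0 < g s) (hβ : F g β = 0) :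
    ∃ v w : ℝ → ℝ, (∀ t, HasDerivAt v (w t) t) ∧ (∀ t, HasDerivAt w (-g (v t)) t) ∧
      v 0 = β ∧ w 0 = 0 ∧ (∀ t, v (-t) = v t) ∧ (∀ t, 0 < v t ∧ v t ≤ β) ∧
      StrictAntiOn v (Ici 0) ∧ Tendsto v atTop (𝓝 0) := by
  obtain ⟨v, w, hv0, hw0, hv, hw⟩ := exists_global_newton hg hC β
  have hvc : Continuous v := continuous_iff_continuousAt.2 fun t => (hv t).continuousAt
  have hE : ∀ t, w t ^ 2 / 2 + F g (v t) = 0 := fun t => by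
    rw [energy_eq hg.continuous hv hw t 0, hv0, hw0, hβ]
    norm_num
  have heven : ∀ t, v (-t) = v t := by
    have := newton_unique hg hv hw (v' := fun t => v (-t)) (w' := fun t => -w (-t)) (t₀ := 0)
      (fun t => by simpa [Function.comp_def] using (hv (-t)).comp t (hasDerivAt_neg t))
      (fun t => by simpa [Function.comp_def] using ((hw (-t)).comp t (hasDerivAt_neg t)).fun_neg) (by simp) (by simp [hw0])
    exact fun t => (congrFun this t).symm
  have hne : ∀ t, v t ≠ 0 := fun t ht => by
    have hwt : w t = 0 := by
      have := hE t
      rw [ht, show F g 0 = 0 from intervalIntegral.integral_same] at this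
      simpa using this
    have := newton_unique hg hv hw (v' := fun _ => 0) (w' := fun _ => 0) (t₀ := t)
      (fun t => hasDerivAt_const t 0) (fun t => by simpa [h0] using hasDerivAt_const t (0 : ℝ))
      ht hwt
    have hβ0 : β = 0 := by rw [← hv0, this]
    linarith
  have hvpos : ∀ t, 0 < v t := fun t => by
    by_contra! ht
    obtain ⟨s, hs⟩ := mem_range_of_exists_le_of_exists_ge hvc ⟨t, ht⟩
      ⟨0, by rw [hv0]; linarith⟩
    exact hne s hs
  have hvle : ∀ t, v t ≤ β := fun t => by
    by_contra! ht
    nlinarith [F_pos hg.continuous hpos haβ hβ ht, hE t]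
  have hturn : ∀ t, w t = 0 → v t = β := fun t ht => by
    by_contra hlt
    have := F_neg hg.continuous ha hneg hpos hβ (hvpos t) ((hvle t).lt_of_ne hlt)
    have := hE t
    rw [ht] at this
    norm_num at this
    linarith
  -- Rolle argument on an interval where `v` is maximal at both ends
  have hlt : ∀ t, 0 < t → v t ≠ β := fun t ht htβ => by
    have hconst : ∀ s ∈ Icc 0 t, v s = β := by
      obtain ⟨m, hm, hmin⟩ := isCompact_Icc.exists_isMinOn (nonempty_Icc.2 ht.le) hvc.continuousOn
      have hmβ : v m = β := by
        rcases eq_or_lt_of_le hm.1 with h | h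
        · rw [← h, hv0]
        rcases eq_or_lt_of_le hm.2 with h' | h'
        · rw [h', htβ]
        exact hturn m ((hmin.isLocalMin (Icc_mem_nhds h h')).hasDerivAt_eq_zero (hv m))
      exact fun s hs => le_antisymm (hvle s) (hmβ ▸ hmin hs)
    obtain ⟨s, hs, hws⟩ := exists_hasDerivAt_eq_slope w (fun t => -g (v t)) ht
      (fun s _ => (hw s).continuousAt.continuousWithinAt) (fun s _ => hw s)
    have hwt : w t = 0 := by
      have := hE t
      rw [htβ, hβ] at this
      simpa using this
    rw [hconst s (Ioo_subset_Icc_self hs), hwt, hw0] at hws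
    have := hpos β haβ
    simp at hws
    linarith
  have hinj : InjOn v (Ici 0) := by
    have key : ∀ x y, 0 ≤ x → x < y → v x ≠ v y := fun x y hx hxy h => by
      obtain ⟨c, hc, hwc⟩ := exists_hasDerivAt_eq_zero hxy hvc.continuousOn h fun s _ => hv s
      exact hlt c (hx.trans_lt hc.1) (hturn c hwc)
    intro x hx y hy hxy
    rcases lt_trichotomy x y with h | h | h
    · exact (key x y hx h hxy).elim
    · exact h
    · exact (key y x hy h hxy.symm).elim
  have hanti : StrictAntiOn v (Ici 0) := fun x hx y hy hxy =>
    hvc.continuousOn.strictAntiOn_of_injOn_Icc hy (hv0 ▸ hvle y) (hinj.mono Icc_subset_Ici_self)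
      ⟨hx, hxy.le⟩ ⟨hy, le_rfl⟩ hxy
  have hw_nonpos : ∀ t, 0 < t → w t ≤ 0 := fun t ht => by
    rw [← (hv t).hasDerivWithinAt.derivWithin (uniqueDiffWithinAt_of_mem_nhds (Ici_mem_nhds ht))]
    exact hanti.antitoneOn.derivWithin_nonpos
  have hsmall : ∀ ε, 0 < ε → ∃ t, 0 ≤ t ∧ v t < ε := by
    intro ε hε
    by_contra! hge
    have hv1 : v 1 < β := (hvle 1).lt_of_ne (hlt 1 one_pos)
    obtain ⟨m, hm, hmax⟩ := isCompact_Icc.exists_isMaxOn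
      (nonempty_Icc.2 (hge 1 zero_le_one)) (continuous_F hg.continuous).continuousOn
    have hFm := F_neg hg.continuous ha hneg hpos hβ (hε.trans_le hm.1) (hm.2.trans_lt hv1)
    set δ := Real.sqrt (-2 * F g m)
    have hδ0 : 0 < δ := Real.sqrt_pos.2 (by linarith)
    have hwδ : ∀ t, 1 ≤ t → w t ≤ -δ := fun t ht => by
      have h1 : F g (v t) ≤ F g m := hmax ⟨hge t (by linarith),
        hanti.antitoneOn (mem_Ici.2 zero_le_one) (mem_Ici.2 (by linarith)) ht⟩
      have h2 : δ ^ 2 = -2 * F g m := Real.sq_sqrt (by linarith)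
      have := hE t
      have := abs_le_of_sq_le_sq (a := δ) (b := -w t) (by nlinarith)
        (by linarith [hw_nonpos t (by linarith)])
      linarith [le_abs_self δ]
    have hT : (1 : ℝ) ≤ 1 + β / δ := by
      have : 0 < β / δ := div_pos (by linarith) hδ0
      linarith
    have hdecay := (convex_Ici (1 : ℝ)).image_sub_le_mul_sub_of_deriv_le hvc.continuousOn
      (fun t _ => (hv t).differentiableAt.differentiableWithinAt) (C := -δ)
      (fun t ht => by rw [(hv t).deriv]; exact hwδ t (interior_subset ht))
      1 self_mem_Ici (1 + β / δ) hT hT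
    have : -δ * (1 + β / δ - 1) = -β := by field_simp; ring
    linarith [hvpos (1 + β / δ)]
  refine ⟨v, w, hv, hw, hv0, hw0, heven, fun t => ⟨hvpos t, hvle t⟩, hanti, ?_⟩
  refine tendsto_order.2 ⟨fun b hb => Eventually.of_forall fun t => hb.trans (hvpos t),
    fun b hb => ?_⟩
  obtain ⟨t, ht, htb⟩ := hsmall b hb
  filter_upwards [eventually_ge_atTop t] with s hs
  exact (hanti.antitoneOn ht (ht.trans hs) hs).trans_lt htb

/-- Existence of the pulse (symmetrically decreasing stationary) solution. -/
theorem exists_pulse_solution (f : ℝ → ℝ) (a β : ℝ) (hf : Bistable f a)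
    (hβ : a < β ∧ β < 1 ∧ F f β = 0) :
    ∃ V : ℝ → ℝ, ContDiff ℝ 2 V ∧
      (∀ x : ℝ, deriv (deriv V) x + f (V x) = 0) ∧
      V 0 = β ∧ deriv V 0 = 0 ∧
      (∀ x : ℝ, V (-x) = V x) ∧
      (∀ x : ℝ, 0 < V x ∧ V x ≤ β) ∧
      StrictAntiOn V (Ici 0) ∧
      Tendsto V atTop (𝓝 0) := by
  obtain ⟨hfC, ha0, -, hf0, -, -, hneg, hpos, -, -, -, -⟩ := hf
  obtain ⟨haβ, hβ1, hFβ⟩ := hβ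
  have hβ0 : 0 ≤ β := by linarith
  -- freeze `f` outside `[0, β]`
  set g : ℝ → ℝ := fun s => f (projIcc 0 β hβ0 s) with hg_def
  have hgf : ∀ s ∈ Icc 0 β, g s = f s := fun s hs => by
    rw [hg_def]
    simp only
    rw [projIcc_of_mem hβ0 hs]
  obtain ⟨K, hK⟩ := (hfC.contDiffOn (s := Icc 0 β)).exists_lipschitzOnWith one_ne_zero
    (convex_Icc 0 β) isCompact_Icc
  have hgL : LipschitzWith (K * 1) g :=
    (LipschitzOnWith.to_restrict hK).comp (LipschitzWith.projIcc hβ0)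
  obtain ⟨C, hC⟩ := isCompact_Icc.exists_bound_of_continuousOn
    (hfC.continuous.continuousOn (s := Icc 0 β))
  have hgF : F g β = 0 := by
    rw [← hFβ]
    refine intervalIntegral.integral_congr fun s hs => hgf s ?_
    rwa [uIcc_of_le hβ0] at hs
  obtain ⟨v, w, hv, hw, hv0, hw0, heven, hbd, hanti, hlim⟩ :=
    exists_pulse_of_lipschitz hgL (fun s => hC _ (projIcc 0 β hβ0 s).2) ha0 haβ
      (by rw [hgf 0 ⟨le_rfl, hβ0⟩, hf0])
      (fun s h0 hsa => by
        rw [hgf s ⟨h0.le, by linarith⟩]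
        exact hneg s h0 hsa)
      (fun s has => by
        rcases le_total s β with h | h
        · rw [hgf s ⟨by linarith, h⟩]
          exact hpos s has (by linarith)
        · rw [hg_def]
          simp only
          rw [projIcc_of_right_le hβ0 h]
          exact hpos β haβ hβ1) hgF
  have hdv : deriv v = w := funext fun t => (hv t).deriv
  have hdw : deriv w = fun t => -g (v t) := funext fun t => (hw t).deriv
  have hvd : Differentiable ℝ v := fun t => (hv t).differentiableAt
  refine ⟨v, ?_, fun x => ?_, hv0, by rw [hdv, hw0], heven, hbd, hanti, hlim⟩
  · rw [show (2 : WithTop ℕ∞) = 1 + 1 by norm_num, contDiff_succ_iff_deriv, hdv,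
      contDiff_one_iff_deriv, hdw]
    exact ⟨hvd, by simp, fun t => (hw t).differentiableAt,
      (hgL.continuous.comp hvd.continuous).neg⟩
  · rw [hdv, hdw, ← hgf (v x) ⟨(hbd x).1.le, (hbd x).2⟩]
    exact neg_add_cancel _
end

section
/- Let T ∈ ℝ. Let u and ũ be continuous real-valued functions on (−∞,T] × [0,∞) with 0 ≤ u ≤ 1 and 0 ≤ ũ ≤ 1, such that u is a classical subsolution and ũ a classical supersolution of ∂_t w = ∂_x² w + f(w) on (−∞,T] × [0,∞) (i.e., ∂_t u, ∂_x u, ∂_x² u exist and are continuous there and ∂_t u ≤ ∂_x² u + f(u), and analogously with ≥ for ũ). Suppose there is a smooth function a₁ : (−∞,T] → [0,∞) such that u(t, a₁(t)) < ũ(t, a₁(t)) for every t ≤ T, and 1 − δ₀ ≤ ũ(t,x) ≤ 1 for every t ≤ T and every x ≥ a₁(t). Then u(t,x) < ũ(t,x) for all t ≤ T and all x ≥ a₁(t). -/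
open Set Filter Topology

/-- `u` is a classical subsolution of `∂_t w = ∂_x² w + f(w)` on `(−∞,T] × [0,∞)`:
`u`, `∂_t u`, `∂_x u`, `∂_x² u` exist and are continuous there, and
`∂_t u ≤ ∂_x² u + f(u)`. -/
def IsSubSol (f : ℝ → ℝ) (T : ℝ) (u : ℝ → ℝ → ℝ) : Prop :=
  ContinuousOn (fun p : ℝ × ℝ => u p.1 p.2) (Iic T ×ˢ Ici 0) ∧
  (∀ t, t ≤ T → ∀ x : ℝ, 0 ≤ x →
    DifferentiableAt ℝ (fun τ => u τ x) t ∧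
    DifferentiableAt ℝ (u t) x ∧
    DifferentiableAt ℝ (deriv (u t)) x) ∧
  ContinuousOn (fun p : ℝ × ℝ => deriv (fun τ => u τ p.2) p.1) (Iic T ×ˢ Ici 0) ∧
  ContinuousOn (fun p : ℝ × ℝ => deriv (u p.1) p.2) (Iic T ×ˢ Ici 0) ∧
  ContinuousOn (fun p : ℝ × ℝ => deriv (deriv (u p.1)) p.2) (Iic T ×ˢ Ici 0) ∧
  (∀ t, t ≤ T → ∀ x : ℝ, 0 ≤ x →
    deriv (fun τ => u τ x) t ≤ deriv (deriv (u t)) x + f (u t x))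

/-- `w` is a classical supersolution of `∂_t w = ∂_x² w + f(w)` on `(−∞,T] × [0,∞)`. -/
def IsSuperSol (f : ℝ → ℝ) (T : ℝ) (u : ℝ → ℝ → ℝ) : Prop :=
  ContinuousOn (fun p : ℝ × ℝ => u p.1 p.2) (Iic T ×ˢ Ici 0) ∧
  (∀ t, t ≤ T → ∀ x : ℝ, 0 ≤ x →
    DifferentiableAt ℝ (fun τ => u τ x) t ∧
    DifferentiableAt ℝ (u t) x ∧
    DifferentiableAt ℝ (deriv (u t)) x) ∧
  ContinuousOn (fun p : ℝ × ℝ => deriv (fun τ => u τ p.2) p.1) (Iic T ×ˢ Ici 0) ∧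
  ContinuousOn (fun p : ℝ × ℝ => deriv (u p.1) p.2) (Iic T ×ˢ Ici 0) ∧
  ContinuousOn (fun p : ℝ × ℝ => deriv (deriv (u p.1)) p.2) (Iic T ×ˢ Ici 0) ∧
  (∀ t, t ≤ T → ∀ x : ℝ, 0 ≤ x →
    deriv (deriv (u t)) x + f (u t x) ≤ deriv (fun τ => u τ x) t)

/-- A function dominated by its value at `s` just before `s` has nonnegative derivative at `s`. -/
theorem HasDerivAt.nonneg_of_eventually_le_left {g : ℝ → ℝ} {d s : ℝ} (hg : HasDerivAt g d s)
    (h : ∀ᶠ τ in 𝓝[<] s, g τ ≤ g s) : 0 ≤ d := by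
  have hs := (hasDerivWithinAt_iff_tendsto_slope' (s := Iio s) (by simp)).1 hg.hasDerivWithinAt
  refine ge_of_tendsto hs ?_
  filter_upwards [h, self_mem_nhdsWithin] with τ hτ hlt
  rw [slope_def_field]
  exact div_nonneg_of_nonpos (by linarith) (by linarith [mem_Iio.1 hlt])

/-- The second derivative is nonpositive at a local maximum. -/
theorem IsLocalMax.second_deriv_nonpos {h g : ℝ → ℝ} {e x : ℝ} (hmax : IsLocalMax h x)
    (hh : ∀ᶠ y in 𝓝 x, HasDerivAt h (g y) y) (hg : HasDerivAt g e x) : e ≤ 0 := by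
  by_contra! he
  have hderiv : deriv h =ᶠ[𝓝 x] g := hh.mono fun y hy => hy.deriv
  have hdd : deriv (deriv h) x = e := by rw [hderiv.deriv_eq, hg.deriv]
  have hmin : IsLocalMin h x := isLocalMin_of_deriv_deriv_pos (by rw [hdd]; exact he)
    hmax.deriv_eq_zero hh.self_of_nhds.continuousAt
  have hconst : h =ᶠ[𝓝 x] fun _ => h x := by
    filter_upwards [hmax, hmin] with y hy hy' using le_antisymm hy hy'
  have hzero : deriv (deriv h) x = 0 := by
    rw [hconst.deriv.deriv_eq]
    simp
  linarith

/-- Weak parabolic maximum principle to the right of a curve `a`: a function that is nonpositive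
on the parabolic boundary, and satisfies `φ_t < φ_xx` wherever it is positive, is nonpositive. -/
theorem parabolic_nonpos_right_of_curve {φ : ℝ → ℝ → ℝ} {a : ℝ → ℝ} {t₀ t₁ R : ℝ}
    (ha : Continuous a) (ha0 : ∀ t ∈ Icc t₀ t₁, 0 ≤ a t)
    (hφ : ContinuousOn (fun p : ℝ × ℝ => φ p.1 p.2) (Icc t₀ t₁ ×ˢ Ici 0))
    (hinit : ∀ x, a t₀ ≤ x → φ t₀ x ≤ 0)
    (hleft : ∀ t ∈ Icc t₀ t₁, φ t (a t) ≤ 0)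
    (hright : ∀ t ∈ Icc t₀ t₁, a t ≤ R → φ t R ≤ 0)
    (hineq : ∀ t ∈ Icc t₀ t₁, ∀ x, a t < x → 0 < φ t x →
      ∃ (d e : ℝ) (g : ℝ → ℝ), HasDerivAt (fun τ => φ τ x) d t ∧
        (∀ᶠ y in 𝓝 x, HasDerivAt (φ t) (g y) y) ∧ HasDerivAt g e x ∧ d < e) :
    ∀ t ∈ Icc t₀ t₁, ∀ x, a t ≤ x → x ≤ R → φ t x ≤ 0 := by
  intro t ht x hax hxR
  by_contra! hpos
  let K : Set (ℝ × ℝ) := (Icc t₀ t₁ ×ˢ Icc 0 R) ∩ {p | a p.1 ≤ p.2}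
  have hK : IsCompact K := (isCompact_Icc.prod isCompact_Icc).inter_right
    (isClosed_le (ha.comp continuous_fst) continuous_snd)
  have hmem : (t, x) ∈ K := ⟨⟨ht, (ha0 t ht).trans hax, hxR⟩, hax⟩
  obtain ⟨⟨s, y⟩, ⟨⟨hs, hy⟩, hasy⟩, hmax⟩ := hK.exists_isMaxOn ⟨_, hmem⟩
    (hφ.mono fun p hp => ⟨hp.1.1, hp.1.2.1⟩)
  change a s ≤ y at hasy
  have hval : 0 < φ s y := hpos.trans_le (hmax hmem)
  have hlt₀ : t₀ < s := by
    refine lt_of_le_of_ne hs.1 ?_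
    rintro rfl
    exact absurd (hinit y hasy) hval.not_ge
  have hlta : a s < y := by
    refine lt_of_le_of_ne hasy fun h => ?_
    exact absurd (h ▸ hleft s hs) hval.not_ge
  have hltR : y < R := by
    refine lt_of_le_of_ne hy.2 fun h => ?_
    subst h
    exact absurd (hright s hs hasy) hval.not_ge
  obtain ⟨d, e, g, hd, hg, he, hde⟩ := hineq s hs y hlta hval
  have hd0 : 0 ≤ d := by
    refine hd.nonneg_of_eventually_le_left ?_
    have hnear : ∀ᶠ τ in 𝓝[<] s, a τ < y :=
      nhdsWithin_le_nhds (ha.continuousAt.eventually_lt_const hlta)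
    filter_upwards [hnear, Ioo_mem_nhdsLT hlt₀] with τ hτ hτs
    exact hmax (a := (τ, y)) ⟨⟨⟨hτs.1.le, hτs.2.le.trans hs.2⟩, hy⟩, hτ.le⟩
  have he0 : e ≤ 0 := by
    refine IsLocalMax.second_deriv_nonpos (h := φ s) ?_ hg he
    filter_upwards [Ioo_mem_nhds hlta hltR] with z hz
    exact hmax (a := (s, z)) ⟨⟨hs, (ha0 s hs).trans hz.1.le, hz.2.le⟩, hz.1.le⟩
  linarith

/-- On an interval where `f' ≤ -σ`, `f` decreases at least linearly. -/
theorem sub_le_neg_mul_of_deriv_le {f : ℝ → ℝ} {σ l r p q : ℝ} (hf : Differentiable ℝ f)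
    (hd : ∀ s ∈ Icc l r, deriv f s ≤ -σ) (hp : l ≤ p) (hpq : p ≤ q) (hq : q ≤ r) :
    f q - f p ≤ -σ * (q - p) :=
  (convex_Icc l r).image_sub_le_mul_sub_of_deriv_le hf.continuous.continuousOn
    hf.differentiableOn (fun s hs => hd s (interior_subset hs)) p ⟨hp, hpq.trans hq⟩ q
    ⟨hp.trans hpq, hq⟩ hpq

/-- The spatial and temporal derivatives of the difference of a subsolution and a supersolution,
corrected by a smooth barrier `b`. -/
theorem exists_hasDerivAt_sub_add {f : ℝ → ℝ} {T : ℝ} {u w b : ℝ → ℝ → ℝ}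
    (hu : IsSubSol f T u) (hw : IsSuperSol f T w) {t x bt bxx : ℝ} {bx : ℝ → ℝ}
    (ht : t ≤ T) (hx : 0 < x) (hbt : HasDerivAt (fun τ => b τ x) bt t)
    (hbx : ∀ y, HasDerivAt (b t) (bx y) y) (hbxx : HasDerivAt bx bxx x)
    (hlt : f (u t x) - f (w t x) + bt < bxx) :
    ∃ (d e : ℝ) (g : ℝ → ℝ), HasDerivAt (fun τ => u τ x - w τ x + b τ x) d t ∧
      (∀ᶠ y in 𝓝 x, HasDerivAt (fun y => u t y - w t y + b t y) (g y) y) ∧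
      HasDerivAt g e x ∧ d < e := by
  obtain ⟨-, hu1, -, -, -, hu2⟩ := hu
  obtain ⟨-, hw1, -, -, -, hw2⟩ := hw
  obtain ⟨hut, -, huxx⟩ := hu1 t ht x hx.le
  obtain ⟨hwt, -, hwxx⟩ := hw1 t ht x hx.le
  refine ⟨_, _, fun y => deriv (u t) y - deriv (w t) y + bx y,
    (hut.hasDerivAt.sub hwt.hasDerivAt).add hbt, ?_,
    (huxx.hasDerivAt.sub hwxx.hasDerivAt).add hbxx, ?_⟩
  · filter_upwards [Ioi_mem_nhds hx] with y hy
    exact ((hu1 t ht y (mem_Ioi.1 hy).le).2.1.hasDerivAt.sub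
      (hw1 t ht y (mem_Ioi.1 hy).le).2.1.hasDerivAt).add (hbx y)
  · linarith [hu2 t ht x hx.le, hw2 t ht x hx.le]

/-- An ancient subsolution bounded by `1` lies below a supersolution to the right of a curve on
which it does, provided `f' ≤ -σ` on the range of the supersolution there. -/
theorem ancient_le_right_of_curve {f : ℝ → ℝ} {δ σ T : ℝ} {u w : ℝ → ℝ → ℝ} {a : ℝ → ℝ}
    (hf : Differentiable ℝ f) (hδ : 0 < δ) (hσ : 0 < σ)
    (hfδ : ∀ s ∈ Icc (1 - δ) 1, deriv f s ≤ -σ)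
    (hu : IsSubSol f T u) (hw : IsSuperSol f T w)
    (hu1 : ∀ t, t ≤ T → ∀ x, 0 ≤ x → u t x ≤ 1)
    (ha : Continuous a) (ha0 : ∀ t, t ≤ T → 0 ≤ a t)
    (hcurve : ∀ t, t ≤ T → u t (a t) ≤ w t (a t))
    (hband : ∀ t, t ≤ T → ∀ x, a t ≤ x → 1 - δ ≤ w t x) :
    ∀ t, t ≤ T → ∀ x, a t ≤ x → u t x ≤ w t x := by
  have hz : ∀ t, t ≤ T → ∀ x, a t ≤ x → u t x - w t x ≤ δ := fun t ht x hx => by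
    linarith [hu1 t ht x ((ha0 t ht).trans hx), hband t ht x hx]
  have key : ∀ t₀ t, t₀ ≤ t → t ≤ T → ∀ x, a t ≤ x → ∀ ε > 0,
      u t x - w t x ≤ δ * Real.exp (-σ * (t - t₀)) + ε * (1 + x ^ 2 + 2 * (t - t₀)) := by
    intro t₀ t ht₀ ht x hx ε hε
    have hx0 : 0 ≤ x := (ha0 t ht).trans hx
    let b : ℝ → ℝ → ℝ := fun t x =>
      -(δ * Real.exp (-σ * (t - t₀)) + ε * (1 + x ^ 2 + 2 * (t - t₀)))
    have hsub : ∀ s ∈ Icc t₀ t, s ≤ T := fun s hs => hs.2.trans ht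
    have hb0 : ∀ s ∈ Icc t₀ t, ∀ y, b s y ≤ -(ε * y ^ 2) := by
      intro s hs y
      have h1 : 0 ≤ δ * Real.exp (-σ * (s - t₀)) := by positivity
      have h2 : 0 ≤ ε * (1 + 2 * (s - t₀)) :=
        mul_nonneg hε.le (by linarith [hs.1])
      simp only [b]
      linarith
    have hmain := parabolic_nonpos_right_of_curve (φ := fun t x => u t x - w t x + b t x)
      (a := a) (t₀ := t₀) (t₁ := t) (R := x + 1 + δ / ε) ha (fun s hs => ha0 s (hsub s hs))
      ?_ ?_ ?_ ?_ ?_ t ⟨ht₀, le_rfl⟩ x hx (by linarith [div_pos hδ hε])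
    · simp only [b] at hmain
      linarith
    · have hmono : Icc t₀ t ×ˢ Ici (0 : ℝ) ⊆ Iic T ×ˢ Ici 0 :=
        prod_mono (fun s hs => hsub s hs) subset_rfl
      exact ((hu.1.mono hmono).sub (hw.1.mono hmono)).add (by simp only [b]; fun_prop)
    · intro y hy
      have := hz t₀ (ht₀.trans ht) y hy
      simp only [b, sub_self, mul_zero, Real.exp_zero]
      nlinarith [mul_nonneg hε.le (sq_nonneg y)]
    · intro s hs
      have h1 := hb0 s hs (a s)
      have h2 := hcurve s (hsub s hs)
      have h3 : 0 ≤ ε * a s ^ 2 := by positivity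
      linarith
    · intro s hs hsR
      have h1 := hb0 s hs (x + 1 + δ / ε)
      have h2 := hz s (hsub s hs) _ hsR
      have h3 : 0 < δ / ε := div_pos hδ hε
      have h4 : δ / ε ≤ (x + 1 + δ / ε) ^ 2 := by nlinarith
      have h5 : δ ≤ ε * (x + 1 + δ / ε) ^ 2 := by
        rw [div_le_iff₀ hε] at h4
        linarith
      linarith
    · intro s hs y hy hpos
      have hsT := hsub s hs
      have hy0 : 0 < y := (ha0 s hsT).trans_lt hy
      refine exists_hasDerivAt_sub_add hu hw hsT hy0
        (bt := -(δ * (Real.exp (-σ * (s - t₀)) * -σ) + ε * 2)) (bxx := -(ε * 2))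
        (bx := fun y => -(ε * (2 * y))) ?_ ?_ ?_ ?_
      · have h1 : HasDerivAt (fun τ : ℝ => τ - t₀) 1 s := (hasDerivAt_id s).sub_const t₀
        have h2 := ((h1.const_mul (-σ)).exp.const_mul δ).add
          (((h1.const_mul 2).const_add (1 + y ^ 2)).const_mul ε)
        exact h2.neg.congr_deriv (by ring)
      · intro y
        have h1 := ((((hasDerivAt_pow 2 y).const_add 1).add_const (2 * (s - t₀))).const_mul
          ε).const_add (δ * Real.exp (-σ * (s - t₀)))
        exact h1.neg.congr_deriv (by simp)
      · exact (((hasDerivAt_id y).const_mul 2).const_mul ε).neg.congr_deriv (by simp)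
      · have hby := hb0 s hs y
        have hεy : 0 ≤ ε * y ^ 2 := by positivity
        have hmvt := sub_le_neg_mul_of_deriv_le hf hfδ (hband s hsT y hy.le)
          (by linarith : w s y ≤ u s y) (hu1 s hsT y hy0.le)
        have hgap : δ * Real.exp (-σ * (s - t₀)) < u s y - w s y := by
          have h2 : 0 ≤ ε * (1 + y ^ 2 + 2 * (s - t₀)) :=
            mul_nonneg hε.le (by nlinarith [hs.1])
          simp only [b] at hpos
          linarith
        nlinarith
  intro t ht x hx
  have hexp : ∀ t₀ ≤ t, u t x - w t x ≤ δ * Real.exp (-σ * (t - t₀)) := by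
    intro t₀ ht₀
    refine le_of_forall_pos_le_add fun ε hε => ?_
    have hD : 0 < 1 + x ^ 2 + 2 * (t - t₀) := by nlinarith [sq_nonneg x]
    have := key t₀ t ht₀ ht x hx (ε / (1 + x ^ 2 + 2 * (t - t₀))) (div_pos hε hD)
    rwa [div_mul_cancel₀ _ hD.ne'] at this
  have hlim : Tendsto (fun r : ℝ => δ * Real.exp (-σ * r)) atTop (𝓝 (δ * 0)) :=
    (Real.tendsto_exp_atBot.comp
      (tendsto_id.const_mul_atTop_of_neg (neg_lt_zero.2 hσ))).const_mul δ
  rw [mul_zero] at hlim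
  have : u t x - w t x ≤ 0 := by
    refine ge_of_tendsto hlim ((eventually_ge_atTop 0).mono fun r hr => ?_)
    have h := hexp (t - r) (by linarith)
    rwa [sub_sub_cancel] at h
  linarith

/-- Strong comparison to the right of a curve: an ordered pair of a subsolution and a supersolution
that is strictly ordered on the curve is strictly ordered to its right. -/
theorem lt_right_of_curve {f : ℝ → ℝ} {T : ℝ} {u w : ℝ → ℝ → ℝ} {a : ℝ → ℝ}
    (hf : ContDiff ℝ 1 f) (hu : IsSubSol f T u) (hw : IsSuperSol f T w)
    (hubd : ∀ t, t ≤ T → ∀ x, 0 ≤ x → 0 ≤ u t x ∧ u t x ≤ 1)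
    (hwbd : ∀ t, t ≤ T → ∀ x, 0 ≤ x → 0 ≤ w t x ∧ w t x ≤ 1)
    (ha : ContDiff ℝ 1 a) (ha0 : ∀ t, t ≤ T → 0 ≤ a t)
    (hcurve : ∀ t, t ≤ T → u t (a t) < w t (a t))
    (hle : ∀ t, t ≤ T → ∀ x, a t ≤ x → u t x ≤ w t x) :
    ∀ t, t ≤ T → ∀ x, a t ≤ x → u t x < w t x := by
  intro t ht x hx
  have hsub : ∀ s ∈ Icc (t - 1) t, s ≤ T := fun s hs => hs.2.trans ht
  have hne : (Icc (t - 1) t).Nonempty := ⟨t, by linarith, le_rfl⟩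
  obtain ⟨L, hL⟩ := (isCompact_Icc (a := (0 : ℝ)) (b := 1)).exists_bound_of_continuousOn
    (hf.continuous_deriv le_rfl).continuousOn
  obtain ⟨M, hM⟩ := (isCompact_Icc (a := t - 1) (b := t)).exists_bound_of_continuousOn
    (ha.continuous_deriv le_rfl).continuousOn
  obtain ⟨A, hA⟩ := (isCompact_Icc (a := t - 1) (b := t)).exists_bound_of_continuousOn
    ha.continuous.continuousOn
  have hL0 : 0 ≤ L := (norm_nonneg _).trans (hL 0 (by simp))
  have hM0 : 0 ≤ M := (norm_nonneg _).trans (hM t ⟨by linarith, le_rfl⟩)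
  have hmono : Icc (t - 1) t ×ˢ Ici (0 : ℝ) ⊆ Iic T ×ˢ Ici 0 :=
    prod_mono (fun s hs => hsub s hs) subset_rfl
  have hcont : ContinuousOn (fun s => w s (a s) - u s (a s)) (Icc (t - 1) t) := by
    have hmaps : MapsTo (fun s => (s, a s)) (Icc (t - 1) t) (Iic T ×ˢ Ici 0) :=
      fun s hs => ⟨hsub s hs, ha0 s (hsub s hs)⟩
    have hgraph : ContinuousOn (fun s => (s, a s)) (Icc (t - 1) t) :=
      (continuous_id.prodMk ha.continuous).continuousOn
    exact (hw.1.comp hgraph hmaps).sub (hu.1.comp hgraph hmaps)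
  obtain ⟨s₀, hs₀, hmin⟩ := isCompact_Icc.exists_isMinOn hne hcont
  obtain ⟨κ, hκ⟩ : ∃ κ, κ = w s₀ (a s₀) - u s₀ (a s₀) := ⟨_, rfl⟩
  have hκ0 : 0 < κ := by linarith [hcurve s₀ (hsub s₀ hs₀)]
  have hκmin : ∀ s ∈ Icc (t - 1) t, κ ≤ w s (a s) - u s (a s) := fun s hs =>
    hκ.trans_le (hmin hs)
  obtain ⟨l, hl⟩ : ∃ l, l = x - a t + 1 := ⟨_, rfl⟩
  have hl0 : 1 ≤ l := by linarith
  obtain ⟨α, hα⟩ : ∃ α, α = M + l + L + 1 := ⟨_, rfl⟩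
  have hα0 : 0 < α := by linarith
  let b : ℝ → ℝ → ℝ := fun s y =>
    κ * (Real.exp (-α * (y - a s)) - Real.exp (-α * (l * (s - (t - 1)))))
  have hmain := parabolic_nonpos_right_of_curve (φ := fun t x => u t x - w t x + b t x)
    (a := a) (t₀ := t - 1) (t₁ := t) (R := A + l) ha.continuous
    (fun s hs => ha0 s (hsub s hs)) ?_ ?_ ?_ ?_ ?_ t ⟨by linarith, le_rfl⟩ x hx ?_
  · have hb : 0 < b t x := by
      refine mul_pos hκ0 (sub_pos.2 (Real.exp_lt_exp.2 ?_))
      nlinarith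
    linarith
  · have hac := ha.continuous
    exact ((hu.1.mono hmono).sub (hw.1.mono hmono)).add (by simp only [b]; fun_prop)
  · intro y hy
    have h1 := hle (t - 1) (by linarith) y hy
    have h2 : b (t - 1) y ≤ 0 := by
      refine mul_nonpos_of_nonneg_of_nonpos hκ0.le (sub_nonpos.2 (Real.exp_le_exp.2 ?_))
      nlinarith
    linarith
  · intro s hs
    have h1 := hκmin s hs
    have h2 : b s (a s) ≤ κ := by
      simp only [b, sub_self, mul_zero, Real.exp_zero]
      nlinarith [Real.exp_pos (-α * (l * (s - (t - 1))))]
    linarith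
  · intro s hs hsR
    have h1 := hle s (hsub s hs) _ hsR
    have h2 : b s (A + l) ≤ 0 := by
      refine mul_nonpos_of_nonneg_of_nonpos hκ0.le (sub_nonpos.2 (Real.exp_le_exp.2 ?_))
      have h3 : a s ≤ A := (le_abs_self _).trans (hA s hs)
      have h4 : l * (s - (t - 1)) ≤ A + l - a s := by nlinarith [hs.2]
      nlinarith
    linarith
  · intro s hs y hy hpos
    have hsT := hsub s hs
    have hy0 : 0 < y := (ha0 s hsT).trans_lt hy
    refine exists_hasDerivAt_sub_add hu hw hsT hy0
      (bt := κ * (Real.exp (-α * (y - a s)) * (α * deriv a s) +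
        Real.exp (-α * (l * (s - (t - 1)))) * (α * l)))
      (bx := fun y => κ * (Real.exp (-α * (y - a s)) * -α))
      (bxx := κ * (Real.exp (-α * (y - a s)) * α ^ 2)) ?_ ?_ ?_ ?_
    · have h1 : HasDerivAt (fun τ => y - a τ) (-deriv a s) s :=
        ((ha.differentiable one_ne_zero s).hasDerivAt).const_sub y
      have h2 : HasDerivAt (fun τ : ℝ => l * (τ - (t - 1))) (l * 1) s :=
        ((hasDerivAt_id s).sub_const (t - 1)).const_mul l
      exact (((h1.const_mul (-α)).exp.sub (h2.const_mul (-α)).exp).const_mul κ).congr_deriv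
        (by ring)
    · intro y
      have h1 : HasDerivAt (fun z => z - a s) 1 y := (hasDerivAt_id y).sub_const (a s)
      exact (((h1.const_mul (-α)).exp.sub_const _).const_mul κ).congr_deriv (by ring)
    · have h1 : HasDerivAt (fun z => z - a s) 1 y := (hasDerivAt_id y).sub_const (a s)
      exact (((h1.const_mul (-α)).exp.mul_const (-α)).const_mul κ).congr_deriv (by ring)
    · have hE : 0 < Real.exp (-α * (y - a s)) := Real.exp_pos _
      have hG : 0 < Real.exp (-α * (l * (s - (t - 1)))) := Real.exp_pos _
      have hz := hle s hsT y hy.le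
      have hb : w s y - u s y < b s y := by linarith
      simp only [b] at hb
      generalize Real.exp (-α * (y - a s)) = E at *
      generalize Real.exp (-α * (l * (s - (t - 1)))) = G at *
      have hGE : G < E := by
        by_contra! h
        nlinarith
      have hlip : f (u s y) - f (w s y) ≤ L * (w s y - u s y) := by
        have h := (convex_Icc (0 : ℝ) 1).norm_image_sub_le_of_norm_deriv_le
          (fun r _ => hf.differentiable one_ne_zero r) hL (hwbd s hsT y hy0.le)
          (hubd s hsT y hy0.le)
        rw [Real.norm_eq_abs, Real.norm_eq_abs, abs_sub_comm (u s y),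
          abs_of_nonneg (sub_nonneg.2 hz)] at h
        exact (le_abs_self _).trans h
      have hlipE : L * (w s y - u s y) ≤ κ * (E * L) := by
        have h1 : w s y - u s y ≤ κ * E := by nlinarith
        nlinarith
      have haM : deriv a s ≤ M := (le_abs_self _).trans (hM s hs)
      have h1 : E * (α * deriv a s) ≤ E * (α * M) := by gcongr
      have h2 : G * (α * l) ≤ E * (α * l) :=
        mul_le_mul_of_nonneg_right hGE.le (by positivity)
      have h3 : L + α * M + α * l < α ^ 2 := by nlinarith
      have h4 : E * (L + α * M + α * l) < E * α ^ 2 := mul_lt_mul_of_pos_left h3 hE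
      have h5 : κ * (E * L + (E * (α * deriv a s) + G * (α * l))) < κ * (E * α ^ 2) :=
        mul_lt_mul_of_pos_left (by linarith) hκ0
      linarith
  · have h3 : a t ≤ A := (le_abs_self _).trans (hA t ⟨by linarith, le_rfl⟩)
    linarith

/-- Comparison of ancient solutions on a half-line, part (i): if the
supersolution stays in `[1−δ₀,1]` to the right of the curve `a₁` and dominates
the subsolution on the curve, then it dominates it to the right of the curve. -/
theorem comparison_ancient_i (f : ℝ → ℝ) (a δ₀ σ₀ : ℝ) (hf : Bistable f a)
    (hδ₀ : 0 < δ₀ ∧ δ₀ < 1/2) (hσ₀ : 0 < σ₀)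
    (hfδ : ∀ s : ℝ, s ∈ Icc 0 δ₀ ∪ Icc (1 - δ₀) 1 → deriv f s ≤ -σ₀)
    (T : ℝ) (u w : ℝ → ℝ → ℝ)
    (hu : IsSubSol f T u) (hw : IsSuperSol f T w)
    (hubd : ∀ t, t ≤ T → ∀ x : ℝ, 0 ≤ x → 0 ≤ u t x ∧ u t x ≤ 1)
    (hwbd : ∀ t, t ≤ T → ∀ x : ℝ, 0 ≤ x → 0 ≤ w t x ∧ w t x ≤ 1)
    (a₁ : ℝ → ℝ) (ha₁ : ContDiff ℝ (⊤ : ℕ∞) a₁) (ha₁0 : ∀ t, t ≤ T → 0 ≤ a₁ t)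
    (hcurve : ∀ t, t ≤ T → u t (a₁ t) < w t (a₁ t))
    (hband : ∀ t, t ≤ T → ∀ x : ℝ, a₁ t ≤ x → 1 - δ₀ ≤ w t x ∧ w t x ≤ 1) :
    ∀ t, t ≤ T → ∀ x : ℝ, a₁ t ≤ x → u t x < w t x := by
  have hdiff : Differentiable ℝ f := hf.1.differentiable one_ne_zero
  refine lt_right_of_curve hf.1 hu hw hubd hwbd (ha₁.of_le (mod_cast le_top)) ha₁0 hcurve ?_
  exact ancient_le_right_of_curve hdiff hδ₀.1 hσ₀ (fun s hs => hfδ s (Or.inr hs)) hu hw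
    (fun t ht x hx => (hubd t ht x hx).2) ha₁.continuous ha₁0 (fun t ht => (hcurve t ht).le)
    (fun t ht x hx => (hband t ht x hx).1)
end

section
/- Let T ∈ ℝ. Let u and ũ be continuous real-valued functions on (−∞,T] × [0,∞) with 0 ≤ u ≤ 1 and 0 ≤ ũ ≤ 1, such that u is a classical subsolution and ũ a classical supersolution of ∂_t w = ∂_x² w + f(w) on (−∞,T] × [0,∞) (i.e., ∂_t u, ∂_x u, ∂_x² u exist and are continuous there and ∂_t u ≤ ∂_x² u + f(u), and analogously with ≥ for ũ). Suppose there is a smooth function a₂ : (−∞,T] → [0,∞) such that u(t, a₂(t)) < ũ(t, a₂(t)) for every t ≤ T, and 0 ≤ u(t,x) ≤ δ₀ for every t ≤ T and every x ≥ a₂(t). Then u(t,x) < ũ(t,x) for all t ≤ T and all x ≥ a₂(t). -/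
open Set Filter Topology

/-- Second derivative test: the second derivative is nonpositive at a local maximum. -/
lemma second_deriv_nonpos_of_isLocalMax {v v' : ℝ → ℝ} {x D : ℝ}
    (hv : ∀ᶠ y in 𝓝 x, HasDerivAt v (v' y) y) (hv' : HasDerivAt v' D x)
    (hmax : IsLocalMax v x) : D ≤ 0 := by
  by_contra! hD
  have hderiv : deriv v =ᶠ[𝓝 x] v' := hv.mono fun y hy => hy.deriv
  have hD' : deriv (deriv v) x = D := by rw [hderiv.deriv_eq, hv'.deriv]
  have hmin : IsLocalMin v x :=
    isLocalMin_of_deriv_deriv_pos (by rwa [hD']) hmax.deriv_eq_zero hv.self_of_nhds.continuousAt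
  have hconst : v =ᶠ[𝓝 x] fun _ => v x := by
    filter_upwards [hmin, hmax] with y h₁ h₂ using le_antisymm h₂ h₁
  have h₀ : deriv (deriv v) x = 0 := by
    rw [hconst.deriv.deriv_eq]
    simp
  linarith

lemma deriv_nonneg_of_left_max {v : ℝ → ℝ} {t D : ℝ} (hv : HasDerivAt v D t)
    (hmax : ∀ᶠ s in 𝓝[<] t, v s ≤ v t) : 0 ≤ D := by
  have hs : Tendsto (slope v t) (𝓝[<] t) (𝓝 D) :=
    hv.tendsto_slope.mono_left (nhdsWithin_mono _ fun s hs => ne_of_lt hs)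
  refine ge_of_tendsto hs ?_
  filter_upwards [hmax, self_mem_nhdsWithin] with s h₁ h₂
  rw [slope_def_field]
  exact div_nonneg_of_nonpos (by linarith) (by linarith [mem_Iio.mp h₂])

/-- The differential inequality satisfied by a smooth `φ` touching the difference of a
subsolution and a supersolution from above, up to an additive constant. -/
lemma contact_inequality {f : ℝ → ℝ} {T : ℝ} {u w φ φx : ℝ → ℝ → ℝ}
    (hu : IsSubSol f T u) (hw : IsSuperSol f T w) {t x φt φxx : ℝ} (ht : t ≤ T) (hx : 0 < x)
    (hφt : HasDerivAt (fun s => φ s x) φt t) (hφx : ∀ y, HasDerivAt (φ t) (φx t y) y)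
    (hφxx : HasDerivAt (φx t) φxx x)
    (hmax_t : ∀ᶠ s in 𝓝[<] t, u s x - w s x - φ s x ≤ u t x - w t x - φ t x)
    (hmax_x : ∀ᶠ y in 𝓝 x, u t y - w t y - φ t y ≤ u t x - w t x - φ t x) :
    φt - φxx ≤ f (u t x) - f (w t x) := by
  obtain ⟨-, hud, -, -, -, hui⟩ := hu
  obtain ⟨-, hwd, -, -, -, hwi⟩ := hw
  have h₁ := deriv_nonneg_of_left_max
    (((hud t ht x hx.le).1.hasDerivAt.sub (hwd t ht x hx.le).1.hasDerivAt).sub hφt) hmax_t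
  have h₂ := second_deriv_nonpos_of_isLocalMax
    (v := fun y => u t y - w t y - φ t y)
    (v' := fun y => deriv (u t) y - deriv (w t) y - φx t y)
    (by
      filter_upwards [lt_mem_nhds hx] with y hy
      exact ((hud t ht y hy.le).2.1.hasDerivAt.sub (hwd t ht y hy.le).2.1.hasDerivAt).sub (hφx y))
    (((hud t ht x hx.le).2.2.hasDerivAt.sub (hwd t ht x hx.le).2.2.hasDerivAt).sub hφxx) hmax_x
  linarith [hui t ht x hx.le, hwi t ht x hx.le]

lemma exists_exp_mul_ge {ε c : ℝ} (hε : 0 < ε) (hc : 0 < c) (y₀ : ℝ) :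
    ∃ y, y₀ ≤ y ∧ 1 ≤ ε * Real.exp (c * y) := by
  have h : Tendsto (fun y => ε * Real.exp (c * y)) atTop atTop :=
    (Real.tendsto_exp_atTop.comp (tendsto_id.const_mul_atTop hc)).const_mul_atTop hε
  exact ((eventually_ge_atTop y₀).and (h.eventually_ge_atTop 1)).exists

/-- Weak comparison to the right of a curve, for ancient sub- and supersolutions such that `f`
dissipates their positive difference. -/
lemma ancient_weak_comparison {f : ℝ → ℝ} {σ T : ℝ} {u w : ℝ → ℝ → ℝ} {c : ℝ → ℝ} (hσ : 0 < σ)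
    (hu : IsSubSol f T u) (hw : IsSuperSol f T w) (hc : Continuous c)
    (hc0 : ∀ t, t ≤ T → 0 ≤ c t) (hcurve : ∀ t, t ≤ T → u t (c t) < w t (c t))
    (hbd : ∀ t, t ≤ T → ∀ x, c t ≤ x → u t x - w t x ≤ 1)
    (hf : ∀ t, t ≤ T → ∀ x, c t ≤ x → w t x ≤ u t x →
      f (u t x) - f (w t x) ≤ -σ * (u t x - w t x)) :
    ∀ t, t ≤ T → ∀ x, c t ≤ x → u t x ≤ w t x := by
  intro t₁ ht₁ x₁ hx₁
  set k := √σ with hk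
  have hk0 : 0 < k := Real.sqrt_pos.2 hσ
  have hkk : k * k = σ := Real.mul_self_sqrt hσ.le
  have key : ∀ ε : ℝ, 0 < ε →
      u t₁ x₁ - w t₁ x₁ ≤ ε * (Real.exp (-σ * t₁) + Real.exp (k * x₁)) := by
    intro ε hε
    by_contra! hpos
    obtain ⟨τ, hτ, hτe⟩ := exists_exp_mul_ge hε hσ (-t₁)
    obtain ⟨X, hX, hXe⟩ := exists_exp_mul_ge hε hk0 x₁
    set g : ℝ → ℝ → ℝ := fun t x => ε * (Real.exp (-σ * t) + Real.exp (k * x)) with hg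
    set S : Set (ℝ × ℝ) := (Icc (-τ) T ×ˢ Icc 0 X) ∩ {p | c p.1 ≤ p.2} with hS
    have hScpt : IsCompact S :=
      (isCompact_Icc.prod isCompact_Icc).inter_right
        (isClosed_le (hc.comp continuous_fst) continuous_snd)
    have hSsub : S ⊆ Iic T ×ˢ Ici 0 := fun p hp => ⟨hp.1.1.2, hp.1.2.1⟩
    have hmem : (t₁, x₁) ∈ S :=
      ⟨⟨⟨by linarith, ht₁⟩, (hc0 t₁ ht₁).trans hx₁, hX⟩, hx₁⟩
    have hcont : ContinuousOn (fun p : ℝ × ℝ => u p.1 p.2 - w p.1 p.2 - g p.1 p.2) S :=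
      ((hu.1.sub hw.1).mono hSsub).sub (by fun_prop)
    obtain ⟨⟨t, x⟩, ⟨⟨⟨hτt, htT⟩, hx0, hxX⟩, hcx⟩, hmax⟩ := hScpt.exists_isMaxOn ⟨_, hmem⟩ hcont
    simp only at hτt htT hx0 hxX
    change c t ≤ x at hcx
    have hmax' : ∀ s y, -τ ≤ s → s ≤ T → 0 ≤ y → y ≤ X → c s ≤ y →
        u s y - w s y - g s y ≤ u t x - w t x - g t x := fun s y h₁ h₂ h₃ h₄ h₅ =>
      hmax (show (s, y) ∈ S from ⟨⟨⟨h₁, h₂⟩, h₃, h₄⟩, h₅⟩)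
    have hmaxpos : g t x < u t x - w t x := by
      have := hmax' t₁ x₁ (by linarith) ht₁ ((hc0 t₁ ht₁).trans hx₁) hX hx₁
      simp only [hg] at this ⊢
      linarith
    have e₁ : 0 < ε * Real.exp (-σ * t) := by positivity
    have e₂ : 0 < ε * Real.exp (k * x) := by positivity
    have hgv : g t x = ε * Real.exp (-σ * t) + ε * Real.exp (k * x) := mul_add _ _ _
    have hb := hbd t htT x hcx
    have hτt' : -τ < t := by
      refine lt_of_le_of_ne hτt fun h => ?_
      rw [← h, show -σ * -τ = σ * τ by ring] at hgv
      rw [← h] at hmaxpos hb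
      linarith
    have hxX' : x < X := by
      refine lt_of_le_of_ne hxX fun h => ?_
      rw [h] at hgv hmaxpos hb
      linarith
    have hcx' : c t < x := by
      refine lt_of_le_of_ne hcx fun h => ?_
      have := hcurve t htT
      rw [h] at this
      linarith
    have hx0' : 0 < x := (hc0 t htT).trans_lt hcx'
    have hcontact := contact_inequality (φ := g) (φx := fun _ y => ε * (k * Real.exp (k * y)))
      (φt := ε * (-σ * Real.exp (-σ * t))) (φxx := ε * (k * (k * Real.exp (k * x))))
      hu hw htT hx0'
      (by
        have := (((hasDerivAt_id t).const_mul (-σ)).exp.add_const (Real.exp (k * x))).const_mul ε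
        refine this.congr_deriv ?_
        simp only [id, mul_one]; ring)
      (fun y => by
        have := (((hasDerivAt_id y).const_mul k).exp.const_add (Real.exp (-σ * t))).const_mul ε
        refine this.congr_deriv ?_
        simp only [id, mul_one]; ring)
      (by
        have := ((((hasDerivAt_id x).const_mul k).exp).const_mul k).const_mul ε
        refine this.congr_deriv ?_
        simp only [id, mul_one]; ring)
      (by
        filter_upwards [self_mem_nhdsWithin, nhdsWithin_le_nhds (lt_mem_nhds hτt'),
          nhdsWithin_le_nhds (hc.continuousAt.eventually_lt continuousAt_const hcx')] with s h₁ h₂ h₃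
        exact hmax' s x h₂.le ((mem_Iio.mp h₁).le.trans htT) hx0 hxX h₃.le)
      (by
        filter_upwards [lt_mem_nhds hx0', gt_mem_nhds hxX', lt_mem_nhds hcx'] with y h₁ h₂ h₃
        exact hmax' t y hτt htT h₁.le h₂.le h₃.le)
    have hdiss := hf t htT x hcx (by linarith)
    have : σ * g t x < σ * (u t x - w t x) := mul_lt_mul_of_pos_left hmaxpos hσ
    rw [hgv] at this
    have hkk' : ε * (k * (k * Real.exp (k * x))) = σ * (ε * Real.exp (k * x)) := by
      rw [← hkk]; ring
    linarith
  have hlim : Tendsto (fun ε : ℝ => ε * (Real.exp (-σ * t₁) + Real.exp (k * x₁)))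
      (𝓝[>] 0) (𝓝 0) := by
    have : Continuous fun ε : ℝ => ε * (Real.exp (-σ * t₁) + Real.exp (k * x₁)) := by fun_prop
    simpa using (this.tendsto 0).mono_left nhdsWithin_le_nhds
  have := ge_of_tendsto hlim (by filter_upwards [self_mem_nhdsWithin] with ε hε using key ε hε)
  linarith

/-- Propagation of strict positivity of `w - u` from the left side `{b}` of a rectangle to its
terminal time. -/
lemma lt_of_lt_on_side {f : ℝ → ℝ} {T K : ℝ} {u w : ℝ → ℝ → ℝ} (hK : 0 ≤ K)
    (hu : IsSubSol f T u) (hw : IsSuperSol f T w) {t₀ η b m x₀ : ℝ} (ht₀ : t₀ ≤ T) (hη : 0 < η)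
    (hb : 0 ≤ b) (hm : 0 < m) (hbx : b < x₀)
    (hle : ∀ t, t₀ - η ≤ t → t ≤ t₀ → ∀ x, b ≤ x → u t x ≤ w t x)
    (hside : ∀ t, t₀ - η ≤ t → t ≤ t₀ → m ≤ w t b - u t b)
    (hf : ∀ t, t₀ - η ≤ t → t ≤ t₀ → ∀ x, b ≤ x →
      f (u t x) - f (w t x) ≤ K * (w t x - u t x)) :
    u t₀ x₀ < w t₀ x₀ := by
  set z := b - 1 with hz
  set R := x₀ + 1 - z with hR
  have hR2 : 2 < R := by linarith
  set M := R ^ 2 / η with hM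
  have hM0 : 0 < M := by positivity
  have hMη : M * η = R ^ 2 := div_mul_cancel₀ _ hη.ne'
  set α := M + K + 3 with hα
  have hα0 : 0 < α := by linarith
  set r : ℝ → ℝ → ℝ := fun t x => (x - z) ^ 2 + M * (t₀ - t) with hr
  set E : ℝ → ℝ → ℝ := fun t x => Real.exp (-α * r t x) with hE
  set C := Real.exp (-α * R ^ 2) with hC
  have hC0 : 0 < C := Real.exp_pos _
  set φ : ℝ → ℝ → ℝ := fun t x => -(m * (E t x - C)) with hφ
  have hEC : ∀ t x, R ^ 2 ≤ r t x → E t x ≤ C := fun t x h => by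
    apply Real.exp_le_exp.2
    nlinarith
  have hE1 : ∀ t x, t ≤ t₀ → E t x ≤ 1 := fun t x h => by
    apply Real.exp_le_one_iff.2
    have : 0 ≤ r t x := by
      have : 0 ≤ t₀ - t := by linarith
      positivity
    nlinarith
  suffices hmain : 0 ≤ w t₀ x₀ - u t₀ x₀ + φ t₀ x₀ by
    have : C < E t₀ x₀ := by
      apply Real.exp_lt_exp.2
      have : r t₀ x₀ < R ^ 2 := by
        simp only [hr, hR]
        nlinarith
      nlinarith
    have : 0 < m * (E t₀ x₀ - C) := mul_pos hm (by linarith)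
    simp only [hφ] at hmain
    linarith
  by_contra! hneg
  set S : Set (ℝ × ℝ) := Icc (t₀ - η) t₀ ×ˢ Icc b (z + R) with hS
  have hSsub : S ⊆ Iic T ×ˢ Ici 0 := fun p hp => ⟨hp.1.2.trans ht₀, hb.trans hp.2.1⟩
  have hmem : (t₀, x₀) ∈ S := ⟨⟨by linarith, le_rfl⟩, hbx.le, by linarith⟩
  have hcont : ContinuousOn (fun p : ℝ × ℝ => u p.1 p.2 - w p.1 p.2 - φ p.1 p.2) S :=
    ((hu.1.sub hw.1).mono hSsub).sub (by fun_prop)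
  obtain ⟨⟨t, x⟩, ⟨⟨hηt, htt⟩, hbx', hxR⟩, hmax⟩ :=
    (isCompact_Icc.prod isCompact_Icc : IsCompact S).exists_isMaxOn ⟨_, hmem⟩ hcont
  simp only at hηt htt hbx' hxR
  have hmax' : ∀ s y, t₀ - η ≤ s → s ≤ t₀ → b ≤ y → y ≤ z + R →
      u s y - w s y - φ s y ≤ u t x - w t x - φ t x := fun s y h₁ h₂ h₃ h₄ =>
    hmax (show (s, y) ∈ S from ⟨⟨h₁, h₂⟩, h₃, h₄⟩)
  have hpos : w t x - u t x < m * (E t x - C) := by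
    have := hmax' t₀ x₀ (by linarith) le_rfl hbx.le (by linarith)
    simp only [hφ] at this hneg
    linarith
  have hr_lt : r t x < R ^ 2 := by
    by_contra! h
    have := hle t hηt htt x hbx'
    have := mul_nonneg hm.le (sub_nonneg.2 (hEC t x h))
    linarith
  have hηt' : t₀ - η < t := by
    refine lt_of_le_of_ne hηt fun h => ?_
    simp only [hr] at hr_lt
    rw [← h, sub_sub_cancel, hMη] at hr_lt
    nlinarith
  have hxR' : x < z + R := by
    refine lt_of_le_of_ne hxR fun h => ?_
    simp only [hr] at hr_lt
    rw [h, add_sub_cancel_left] at hr_lt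
    have : 0 ≤ M * (t₀ - t) := mul_nonneg hM0.le (by linarith)
    linarith
  have hbx'' : b < x := by
    refine lt_of_le_of_ne hbx' fun h => ?_
    rw [← h] at hpos
    have := hside t hηt htt
    have : m * (E t b - C) ≤ m * 1 := mul_le_mul_of_nonneg_left (by linarith [hE1 t b htt]) hm.le
    linarith
  have hrx : ∀ y, HasDerivAt (r t) (2 * (y - z)) y := fun y => by
    have := (((hasDerivAt_id y).sub_const z).pow 2).add_const (M * (t₀ - t))
    refine this.congr_deriv ?_
    simp
  have hEx : ∀ y, HasDerivAt (E t) (E t y * (-α * (2 * (y - z)))) y := fun y =>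
    ((hrx y).const_mul (-α)).exp
  have hcontact := contact_inequality (φ := φ)
    (φx := fun s y => -(m * (E s y * (-α * (2 * (y - z))))))
    (φt := -(m * (E t x * (α * M))))
    (φxx := -(m * (E t x * (-α * (2 * (x - z))) * (-α * (2 * (x - z))) + E t x * (-α * 2))))
    hu hw (htt.trans ht₀) (hb.trans_lt hbx'')
    (by
      have h₁ : HasDerivAt (fun s => r s x) (-M) t := by
        have := (((hasDerivAt_id t).const_sub t₀).const_mul M).const_add ((x - z) ^ 2)
        refine this.congr_deriv ?_
        simp
      have h₂ := (((h₁.const_mul (-α)).exp.sub_const C).const_mul m).neg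
      refine h₂.congr_deriv ?_
      simp only [hE]; ring)
    (fun y => (((hEx y).sub_const C).const_mul m).neg)
    (by
      have h₁ : HasDerivAt (fun y => -α * (2 * (y - z))) (-α * 2) x := by
        have := (((hasDerivAt_id x).sub_const z).const_mul 2).const_mul (-α)
        refine this.congr_deriv ?_
        simp
      have h₂ := (((hEx x).mul h₁).const_mul m).neg
      refine h₂.congr_deriv ?_
      ring)
    (by
      filter_upwards [self_mem_nhdsWithin, nhdsWithin_le_nhds (lt_mem_nhds hηt')] with s h₁ h₂
      exact hmax' s x h₂.le ((mem_Iio.mp h₁).le.trans htt) hbx' hxR)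
    (by
      filter_upwards [lt_mem_nhds hbx'', gt_mem_nhds hxR'] with y h₁ h₂
      exact hmax' t y hηt htt h₁.le h₂.le)
  have hreact := hf t hηt htt x hbx'
  have hE0 : 0 < E t x := Real.exp_pos _
  have h₁ : K * (w t x - u t x) ≤ K * (m * E t x) := by
    apply mul_le_mul_of_nonneg_left _ hK
    have := mul_pos hm hC0
    linarith
  have h₂ : 0 ≤ m * E t x * (α * M + 2 * α + K - 4 * α ^ 2 * (x - z) ^ 2) := by linarith
  have h₃ : 0 ≤ α * M + 2 * α + K - 4 * α ^ 2 * (x - z) ^ 2 :=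
    nonneg_of_mul_nonneg_right h₂ (mul_pos hm hE0)
  have h₄ : 1 ≤ (x - z) ^ 2 := by nlinarith
  have h₅ : α ^ 2 ≤ α ^ 2 * (x - z) ^ 2 := le_mul_of_one_le_right (sq_nonneg _) h₄
  have h₆ : K ≤ α * K := le_mul_of_one_le_left hK (by linarith)
  have h₇ : α ^ 2 = α * M + α * K + 3 * α := by rw [hα]; ring
  linarith [mul_pos hα0 hM0]

/-- Comparison of ancient solutions on a half-line, part (ii): if the
subsolution stays in `[0,δ₀]` to the right of the curve `a₂` and is dominated
by the supersolution on the curve, then it is dominated to the right of it. -/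
theorem comparison_ancient_ii (f : ℝ → ℝ) (a δ₀ σ₀ : ℝ) (hf : Bistable f a)
    (hδ₀ : 0 < δ₀ ∧ δ₀ < 1/2) (hσ₀ : 0 < σ₀)
    (hfδ : ∀ s : ℝ, s ∈ Icc 0 δ₀ ∪ Icc (1 - δ₀) 1 → deriv f s ≤ -σ₀)
    (T : ℝ) (u w : ℝ → ℝ → ℝ)
    (hu : IsSubSol f T u) (hw : IsSuperSol f T w)
    (hubd : ∀ t, t ≤ T → ∀ x : ℝ, 0 ≤ x → 0 ≤ u t x ∧ u t x ≤ 1)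
    (hwbd : ∀ t, t ≤ T → ∀ x : ℝ, 0 ≤ x → 0 ≤ w t x ∧ w t x ≤ 1)
    (a₂ : ℝ → ℝ) (ha₂ : ContDiff ℝ (⊤ : ℕ∞) a₂) (ha₂0 : ∀ t, t ≤ T → 0 ≤ a₂ t)
    (hcurve : ∀ t, t ≤ T → u t (a₂ t) < w t (a₂ t))
    (hband : ∀ t, t ≤ T → ∀ x : ℝ, a₂ t ≤ x → 0 ≤ u t x ∧ u t x ≤ δ₀) :
    ∀ t, t ≤ T → ∀ x : ℝ, a₂ t ≤ x → u t x < w t x := by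
  have hdiff : Differentiable ℝ f := hf.1.differentiable (by norm_num)
  have hweak : ∀ t, t ≤ T → ∀ x, a₂ t ≤ x → u t x ≤ w t x := by
    refine ancient_weak_comparison hσ₀ hu hw ha₂.continuous ha₂0 hcurve ?_ ?_
    · intro t ht x hx
      have hx0 := (ha₂0 t ht).trans hx
      linarith [(hubd t ht x hx0).2, (hwbd t ht x hx0).1]
    · intro t ht x hx hwu
      have hw0 := (hwbd t ht x ((ha₂0 t ht).trans hx)).1
      have huδ := (hband t ht x hx).2
      exact (convex_Icc 0 δ₀).image_sub_le_mul_sub_of_deriv_le hdiff.continuous.continuousOn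
        hdiff.differentiableOn (fun s hs => hfδ s (Or.inl (interior_subset hs)))
        _ ⟨hw0, hwu.trans huδ⟩ _ ⟨hw0.trans hwu, huδ⟩ hwu
  obtain ⟨K, hK⟩ := (isCompact_Icc (a := (0 : ℝ)) (b := 1)).exists_bound_of_continuousOn
    (hf.1.continuous_deriv le_rfl).continuousOn
  have hK0 : 0 ≤ K := (norm_nonneg _).trans (hK 0 ⟨le_rfl, zero_le_one⟩)
  intro t₀ ht₀ x₀ hx₀
  rcases hx₀.eq_or_lt with rfl | hx₀
  · exact hcurve t₀ ht₀
  obtain ⟨m, hm, hm'⟩ := exists_between (sub_pos.2 (hcurve t₀ ht₀))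
  have hcont : ContinuousWithinAt (fun p : ℝ × ℝ => w p.1 p.2 - u p.1 p.2) (Iic T ×ˢ Ici 0)
      (t₀, a₂ t₀) := (hw.1.sub hu.1) _ ⟨ht₀, ha₂0 t₀ ht₀⟩
  obtain ⟨ε, hε, hball⟩ := Metric.mem_nhdsWithin_iff.1 (hcont.eventually (lt_mem_nhds hm'))
  obtain ⟨b, hab, hb⟩ := exists_between (lt_min hx₀ (lt_add_of_pos_right (a₂ t₀) hε))
  obtain ⟨hbx, hbε⟩ := lt_min_iff.1 hb
  obtain ⟨ρ, hρ, hcurveb⟩ := Metric.eventually_nhds_iff.1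
    (ha₂.continuous.continuousAt.eventually_lt continuousAt_const hab)
  obtain ⟨η, hη, hη'⟩ := exists_between (lt_min hε hρ)
  obtain ⟨hηε, hηρ⟩ := lt_min_iff.1 hη'
  have hb0 : 0 ≤ b := (ha₂0 t₀ ht₀).trans hab.le
  have hcb : ∀ t, t₀ - η ≤ t → t ≤ t₀ → a₂ t < b := fun t h₁ h₂ =>
    hcurveb (by rw [Real.dist_eq, abs_lt]; constructor <;> linarith)
  refine lt_of_lt_on_side (K := K) hK0 hu hw ht₀ hη hb0 hm hbx ?_ ?_ ?_
  · intro t h₁ h₂ x hx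
    exact hweak t (h₂.trans ht₀) x ((hcb t h₁ h₂).le.trans hx)
  · intro t h₁ h₂
    refine le_of_lt (hball (a := (t, b)) ⟨?_, ⟨h₂.trans ht₀, hb0⟩⟩)
    rw [Metric.mem_ball, Prod.dist_eq, max_lt_iff, Real.dist_eq, Real.dist_eq, abs_lt, abs_lt]
    refine ⟨⟨?_, ?_⟩, ?_, ?_⟩ <;> simp only <;> linarith
  · intro t h₁ h₂ x hx
    have hle := hweak t (h₂.trans ht₀) x ((hcb t h₁ h₂).le.trans hx)
    have := (convex_Icc (0 : ℝ) 1).mul_sub_le_image_sub_of_le_deriv hdiff.continuous.continuousOn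
      hdiff.differentiableOn
      (fun s hs => (abs_le.1 (hK s (interior_subset hs))).1)
      _ (hubd t (h₂.trans ht₀) x (hb0.trans hx)) _ (hwbd t (h₂.trans ht₀) x (hb0.trans hx)) hle
    linarith
end
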